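/- Let V be a Whittaker module for U_q(f_m(K)) with cyclic Whittaker vector w of type η, and let Z_V = Ann(V) ∩ Z(U_q(f_m(K))). Then the annihilator of w equals U_q(f_m(K))·Z_V + U_q(f_m(K))·U_{q,η}(E). -/

import Mathlib

noncomputable section

inductive UqGen : Type
  | E : UqGen
  | F : UqGen
  | K : UqGen
  | Kinv : UqGen

def lpow {A : Type*} [Monoid A] (x xinv : A) (n : ℤ) : A :=
  if 0 ≤ n then x ^ n.toNat else xinv ^ (-n).toNat

open FreeAlgebra in
inductive UqRel (q : ℂ) (m : ℕ) : FreeAlgebra ℂ UqGen → FreeAlgebra ℂ UqGen → Prop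
  | KE : UqRel q m (ι ℂ UqGen.K * ι ℂ UqGen.E) (q ^ 2 • (ι ℂ UqGen.E * ι ℂ UqGen.K))
  | KF : UqRel q m (ι ℂ UqGen.K * ι ℂ UqGen.F) ((q ^ 2)⁻¹ • (ι ℂ UqGen.F * ι ℂ UqGen.K))
  | KKinv : UqRel q m (ι ℂ UqGen.K * ι ℂ UqGen.Kinv) 1
  | KinvK : UqRel q m (ι ℂ UqGen.Kinv * ι ℂ UqGen.K) 1
  | EF : UqRel q m (ι ℂ UqGen.E * ι ℂ UqGen.F - ι ℂ UqGen.F * ι ℂ UqGen.E)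
      ((q - q⁻¹)⁻¹ • ((ι ℂ UqGen.K) ^ m - (ι ℂ UqGen.Kinv) ^ m))

abbrev Uq (q : ℂ) (m : ℕ) : Type := RingQuot (UqRel q m)

def Egen (q : ℂ) (m : ℕ) : Uq q m := RingQuot.mkAlgHom ℂ (UqRel q m) (FreeAlgebra.ι ℂ UqGen.E)
def Fgen (q : ℂ) (m : ℕ) : Uq q m := RingQuot.mkAlgHom ℂ (UqRel q m) (FreeAlgebra.ι ℂ UqGen.F)
def Kgen (q : ℂ) (m : ℕ) : Uq q m := RingQuot.mkAlgHom ℂ (UqRel q m) (FreeAlgebra.ι ℂ UqGen.K)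
def Kinvgen (q : ℂ) (m : ℕ) : Uq q m := RingQuot.mkAlgHom ℂ (UqRel q m) (FreeAlgebra.ι ℂ UqGen.Kinv)

def Kzpow (q : ℂ) (m : ℕ) (n : ℤ) : Uq q m := lpow (Kgen q m) (Kinvgen q m) n

def Casimir (q : ℂ) (m : ℕ) : Uq q m :=
  Fgen q m * Egen q m +
    (((q ^ (2 * m) - 1) * (q - q⁻¹))⁻¹ * q ^ (2 * m)) • Kgen q m ^ m +
    ((q ^ (2 * m) - 1) * (q - q⁻¹))⁻¹ • Kinvgen q m ^ m


open Polynomial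

section Abstract

variable {A : Type*} [Ring A] [Algebra ℂ A]

theorem zpow_mul_eq_smul {k : Aˣ} {x : A} {c : ℂ} (hc : c ≠ 0)
    (h : (k : A) * x = c • (x * k)) (n : ℤ) :
    ((k ^ n : Aˣ) : A) * x = c ^ n • (x * ((k ^ n : Aˣ) : A)) := by
  let c' : Aˣ := Units.map (algebraMap ℂ A).toMonoidHom (Units.mk0 c hc)
  have hcomm : Commute c' k := Units.ext (Algebra.commutes c (k : A))
  have hs : SemiconjBy x ((c' * k : Aˣ) : A) k := by
    change x * (algebraMap ℂ A c * k) = k * x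
    rw [h, ← Algebra.smul_def, mul_smul_comm]
  have hn := (hs.units_zpow_right n).eq
  have hc' : ((c' ^ n : Aˣ) : A) = algebraMap ℂ A (c ^ n) := by
    rw [← map_zpow]
    change algebraMap ℂ A ((Units.mk0 c hc ^ n : ℂˣ) : ℂ) = _
    rw [Units.val_zpow_eq_zpow_val, Units.val_mk0]
  rw [← hn, hcomm.mul_zpow, Units.val_mul, hc', ← Algebra.smul_def, mul_smul_comm]

theorem mem_center_of_adjoin_eq_top {s : Set A} (hs : Algebra.adjoin ℂ s = ⊤) {z : A}
    (hz : ∀ x ∈ s, Commute x z) : z ∈ Subalgebra.center ℂ A := by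
  rw [Subalgebra.mem_center_iff]
  intro b
  have hle : Algebra.adjoin ℂ s ≤ Subalgebra.centralizer ℂ {z} :=
    Algebra.adjoin_le fun x hx y hy => by
      rw [Set.mem_singleton_iff.1 hy]
      exact (hz x hx).symm.eq
  have hb : b ∈ Subalgebra.centralizer ℂ {z} := hle (hs ▸ Algebra.mem_top)
  exact (hb z rfl).symm

/-- A subspace containing `1` and stable under left multiplication by generators is everything. -/
theorem eq_top_of_mul_mem {s : Set A} (hs : Algebra.adjoin ℂ s = ⊤) {N : Submodule ℂ A}
    (h1 : (1 : A) ∈ N) (hN : ∀ x ∈ s, ∀ y ∈ N, x * y ∈ N) : N = ⊤ := by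
  rw [eq_top_iff]
  intro u _
  have hu : u ∈ Algebra.adjoin ℂ s := hs ▸ Algebra.mem_top
  have key : ∀ y ∈ N, u * y ∈ N := by
    clear * - hu hN
    induction hu using Algebra.adjoin_induction with
    | mem x hx => exact hN x hx
    | algebraMap r =>
      intro y hy
      rw [← Algebra.smul_def]
      exact N.smul_mem r hy
    | add a b _ _ ha hb =>
      intro y hy
      rw [add_mul]
      exact N.add_mem (ha y hy) (hb y hy)
    | mul a b _ _ ha hb =>
      intro y hy
      rw [mul_assoc]
      exact ha _ (hb y hy)
  simpa using key 1 h1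

theorem casimir_mem_center {E F : A} {K : Aˣ} {m : ℕ} {q d c : ℂ} (hq0 : q ≠ 0)
    (hs : Algebra.adjoin ℂ ({E, F, (K : A), ((K⁻¹ : Aˣ) : A)} : Set A) = ⊤)
    (hKE : (K : A) * E = q ^ 2 • (E * K)) (hKF : (K : A) * F = (q ^ 2)⁻¹ • (F * K))
    (hEF : E * F - F * E = d • ((K : A) ^ m - ((K⁻¹ : Aˣ) : A) ^ m))
    (hc : c * (q ^ (2 * m) - 1) = d) :
    F * E + (c * q ^ (2 * m)) • (K : A) ^ m + c • ((K⁻¹ : Aˣ) : A) ^ m ∈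
      Subalgebra.center ℂ A := by
  have hq2 : q ^ 2 ≠ 0 := pow_ne_zero 2 hq0
  have hQ : q ^ (2 * m) ≠ 0 := pow_ne_zero _ hq0
  have hpE := zpow_mul_eq_smul hq2 hKE (m : ℤ)
  have hnE := zpow_mul_eq_smul hq2 hKE (-m : ℤ)
  have hpF := zpow_mul_eq_smul (inv_ne_zero hq2) hKF (m : ℤ)
  have hnF := zpow_mul_eq_smul (inv_ne_zero hq2) hKF (-m : ℤ)
  have hKFE : (K : A) * (F * E) = F * E * K := by
    rw [← mul_assoc, hKF, smul_mul_assoc, mul_assoc, hKE, mul_smul_comm, smul_smul,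
      inv_mul_cancel₀ hq2, one_smul, mul_assoc]
  simp only [zpow_neg, zpow_natCast, inv_pow, inv_inv, ← pow_mul] at hpE hnE hpF hnF
  have hL : ((K⁻¹ : Aˣ) : A) ^ m = (((K ^ m)⁻¹ : Aˣ) : A) := by
    rw [← Units.val_pow_eq_pow_val, inv_pow]
  rw [hL, ← Units.val_pow_eq_pow_val] at hEF ⊢
  have hKc : Commute (K : A)
      (F * E + (c * q ^ (2 * m)) • ((K ^ m : Aˣ) : A) + c • (((K ^ m)⁻¹ : Aˣ) : A)) := by
    have h1 : Commute (K : A) ((K ^ m : Aˣ) : A) := by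
      rw [Units.val_pow_eq_pow_val]
      exact Commute.pow_right rfl m
    exact (Commute.add_right hKFE (h1.smul_right _)).add_right (h1.units_inv_right.smul_right _)
  have hEF' := sub_eq_iff_eq_add.1 hEF
  refine mem_center_of_adjoin_eq_top hs fun x hx => ?_
  simp only [Set.mem_insert_iff, Set.mem_singleton_iff] at hx
  rcases hx with rfl | rfl | rfl | rfl
  · change _ * _ = _ * _
    simp only [mul_add, add_mul, smul_mul_assoc, mul_smul_comm, hpE, hnE, ← mul_assoc, hEF',
      smul_sub, sub_mul, smul_smul, ← hc]
    match_scalars <;> field_simp <;> ring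
  · change _ * _ = _ * _
    simp only [mul_add, add_mul, smul_mul_assoc, mul_smul_comm, hpF, hnF, mul_assoc, hEF',
      smul_sub, mul_sub, smul_smul, ← hc]
    match_scalars <;> field_simp <;> ring
  · exact hKc
  · exact hKc.units_inv_left

/-- The subspace of elements `p(Z) * K ^ b`. -/
def casimirWeight (Z : A) (K : Aˣ) (b : ℤ) : ℂ[X] →ₗ[ℂ] A :=
  LinearMap.mulRight ℂ ((K ^ b : Aˣ) : A) ∘ₗ (aeval Z).toLinearMap

theorem casimirWeight_apply (Z : A) (K : Aˣ) (b : ℤ) (p : ℂ[X]) :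
    casimirWeight Z K b p = aeval Z p * ((K ^ b : Aˣ) : A) := rfl

theorem aeval_mem_center {Z : A} (hZ : Z ∈ Subalgebra.center ℂ A) (p : ℂ[X]) :
    aeval Z p ∈ Subalgebra.center ℂ A :=
  Algebra.adjoin_le (Set.singleton_subset_iff.2 hZ) (aeval_mem_adjoin_singleton ℂ Z)

theorem span_sup_casimirWeight_eq_top {E F Z : A} {K : Aˣ} {m : ℕ} {q e α β : ℂ} (hq0 : q ≠ 0)
    (he : e ≠ 0)
    (hs : Algebra.adjoin ℂ ({E, F, (K : A), ((K⁻¹ : Aˣ) : A)} : Set A) = ⊤)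
    (hKE : (K : A) * E = q ^ 2 • (E * K)) (hKF : (K : A) * F = (q ^ 2)⁻¹ • (F * K))
    (hZ : Z ∈ Subalgebra.center ℂ A)
    (hZdef : Z = F * E + α • (K : A) ^ m + β • ((K⁻¹ : Aˣ) : A) ^ m) :
    (Submodule.span A {E - algebraMap ℂ A e}).restrictScalars ℂ ⊔
      ⨆ b, LinearMap.range (casimirWeight Z K b) = ⊤ := by
  set J := Submodule.span A {E - algebraMap ℂ A e}
  set N := J.restrictScalars ℂ ⊔ ⨆ b, LinearMap.range (casimirWeight Z K b)
  have hq2 : q ^ 2 ≠ 0 := pow_ne_zero 2 hq0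
  have hJN : ∀ x ∈ J, x ∈ N := fun x hx => Submodule.mem_sup_left hx
  have hJm : ∀ x : A, x * (E - algebraMap ℂ A e) ∈ N := fun x =>
    hJN _ (J.smul_mem x (Submodule.mem_span_singleton_self _))
  have hWN : ∀ (b : ℤ) (p : ℂ[X]), aeval Z p * ((K ^ b : Aˣ) : A) ∈ N := fun b p =>
    Submodule.mem_sup_right (Submodule.mem_iSup_of_mem b ⟨p, rfl⟩)
  have stable : ∀ x : A, (∀ (b : ℤ) (p : ℂ[X]), aeval Z p * (x * ((K ^ b : Aˣ) : A)) ∈ N) →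
      ∀ y ∈ N, x * y ∈ N := by
    intro x hx
    suffices N ≤ N.comap (LinearMap.mulLeft ℂ x) from fun y hy => this hy
    refine sup_le (fun y hy => hJN _ (J.smul_mem x hy)) (iSup_le fun b => ?_)
    rintro _ ⟨p, rfl⟩
    have hcp := Subalgebra.mem_center_iff.1 (aeval_mem_center hZ p) x
    change x * (aeval Z p * _) ∈ N
    rw [← mul_assoc, hcp, mul_assoc]
    exact hx b p
  refine eq_top_of_mul_mem hs (by simpa using hWN 0 1) fun x hx => stable x fun b p => ?_
  simp only [Set.mem_insert_iff, Set.mem_singleton_iff] at hx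
  rcases hx with rfl | rfl | rfl | rfl
  · have h := zpow_mul_eq_smul hq2 hKE b
    have h' : x * ((K ^ b : Aˣ) : A) = ((q ^ 2) ^ b)⁻¹ • (((K ^ b : Aˣ) : A) * x) := by
      rw [h, smul_smul, inv_mul_cancel₀ (zpow_ne_zero _ hq2), one_smul]
    have h2 : aeval Z p * (x * ((K ^ b : Aˣ) : A)) = ((q ^ 2) ^ b)⁻¹ •
        (aeval Z p * ((K ^ b : Aˣ) : A) * (x - algebraMap ℂ A e) +
          e • (aeval Z p * ((K ^ b : Aˣ) : A))) := by
      rw [h', mul_sub, ← Algebra.commutes e, ← Algebra.smul_def, sub_add_cancel, mul_smul_comm,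
        mul_assoc]
    rw [h2]
    exact N.smul_mem _ (N.add_mem (hJm _) (N.smul_mem _ (hWN _ _)))
  · have h := zpow_mul_eq_smul (inv_ne_zero hq2) hKF b
    have h' : x * ((K ^ b : Aˣ) : A) = (((q ^ 2)⁻¹) ^ b)⁻¹ • (((K ^ b : Aˣ) : A) * x) := by
      rw [h, smul_smul, inv_mul_cancel₀ (zpow_ne_zero _ (inv_ne_zero hq2)), one_smul]
    have hF : x = e⁻¹ • (Z - α • (K : A) ^ m - β • ((K⁻¹ : Aˣ) : A) ^ m -
        x * (E - algebraMap ℂ A e)) := by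
      rw [hZdef, mul_sub, ← Algebra.commutes e, ← Algebra.smul_def]
      match_scalars <;> field_simp <;> ring
    rw [h', mul_smul_comm]
    refine N.smul_mem _ ?_
    rw [hF, ← mul_assoc, mul_smul_comm]
    refine N.smul_mem _ ?_
    rw [mul_sub, mul_sub, mul_sub, mul_smul_comm, mul_smul_comm, ← mul_assoc _ x]
    refine N.sub_mem (N.sub_mem (N.sub_mem ?_ (N.smul_mem _ ?_)) (N.smul_mem _ ?_)) (hJm _)
    · have := hWN b (X * p)
      rwa [map_mul, aeval_X, mul_assoc, ← Subalgebra.mem_center_iff.1 hZ] at this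
    · have := hWN (b + m) p
      rwa [zpow_add, zpow_natCast, Units.val_mul, Units.val_pow_eq_pow_val, ← mul_assoc] at this
    · have := hWN (b + -m) p
      rwa [zpow_add, zpow_neg, zpow_natCast, ← inv_pow, Units.val_mul, Units.val_pow_eq_pow_val,
        ← mul_assoc] at this
  · have := hWN (1 + b) p
    rwa [zpow_add, zpow_one, Units.val_mul] at this
  · have := hWN (-1 + b) p
    rwa [zpow_add, zpow_neg_one, Units.val_mul] at this

theorem eq_zero_of_sum_eigenvectors_eq_zero {V ι : Type*} [AddCommGroup V] [Module A V] {E : A}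
    {μ : ι → ℂ} (hμ : Function.Injective μ) {v : ι → V}
    (hv : ∀ i, E • v i = algebraMap ℂ A (μ i) • v i) {s : Finset ι} (h0 : ∑ i ∈ s, v i = 0) :
    ∀ i ∈ s, v i = 0 := by
  let _ : Module ℂ V := Module.compHom V (algebraMap ℂ A)
  have : IsScalarTower ℂ A V := ⟨fun c a x => by
    rw [Algebra.smul_def, mul_smul]; rfl⟩
  let f : Module.End ℂ V := Module.toModuleEnd ℂ V E
  have hind := (Module.End.eigenspaces_iSupIndep f).comp hμ
  have hmem : ∀ i, v i ∈ f.eigenspace (μ i) := fun i =>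
    Module.End.mem_eigenspace_iff.2 (hv i)
  exact (iSupIndep_iff_finsetSum_eq_zero_imp_eq_zero _).1 hind s v (fun i _ => hmem i) h0

theorem annihilator_whittaker_le_span {V : Type*} [AddCommGroup V] [Module A V] {w : V}
    {E F Z : A} {K : Aˣ} {m : ℕ} {q e α β : ℂ} (hq0 : q ≠ 0)
    (hq : ∀ k : ℕ, 0 < k → q ^ k ≠ 1) (he : e ≠ 0)
    (hs : Algebra.adjoin ℂ ({E, F, (K : A), ((K⁻¹ : Aˣ) : A)} : Set A) = ⊤)
    (hKE : (K : A) * E = q ^ 2 • (E * K)) (hKF : (K : A) * F = (q ^ 2)⁻¹ • (F * K))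
    (hZ : Z ∈ Subalgebra.center ℂ A)
    (hZdef : Z = F * E + α • (K : A) ^ m + β • ((K⁻¹ : Aˣ) : A) ^ m)
    (hw : E • w = algebraMap ℂ A e • w) (hcyc : ∀ v : V, ∃ u : A, v = u • w)
    {u : A} (hu : u • w = 0) :
    u ∈ Submodule.span A ({z : A | z ∈ Subalgebra.center ℂ A ∧ ∀ v : V, z • v = 0} ∪
      {E - algebraMap ℂ A e}) := by
  set S := Submodule.span A ({z : A | z ∈ Subalgebra.center ℂ A ∧ ∀ v : V, z • v = 0} ∪
    {E - algebraMap ℂ A e})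
  have hq2 : q ^ 2 ≠ 0 := pow_ne_zero 2 hq0
  have hmem : u ∈ (Submodule.span A {E - algebraMap ℂ A e}).restrictScalars ℂ ⊔
      ⨆ b, LinearMap.range (casimirWeight Z K b) := by
    rw [span_sup_casimirWeight_eq_top hq0 he hs hKE hKF hZ hZdef]
    trivial
  obtain ⟨j, hj, t, ht, rfl⟩ := Submodule.mem_sup.1 hmem
  have hjS : j ∈ S := Submodule.span_mono Set.subset_union_right hj
  have hjw : j • w = 0 := by
    obtain ⟨a, rfl⟩ := Submodule.mem_span_singleton.1 hj
    rw [smul_eq_mul, mul_smul, sub_smul, hw, sub_self, smul_zero]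
  rw [add_smul, hjw, zero_add] at hu
  obtain ⟨g, hg, rfl⟩ := (Submodule.mem_iSup_iff_exists_finsupp _ _).1 ht
  choose p hp using hg
  simp only [casimirWeight_apply] at hp
  rw [Finsupp.sum, Finset.sum_smul] at hu
  have hcp := fun b => Subalgebra.mem_center_iff.1 (aeval_mem_center hZ (p b))
  have hinj : Function.Injective fun b : ℤ => ((q ^ 2) ^ b)⁻¹ * e := by
    intro a b hab
    have h1 := inv_injective (mul_right_cancel₀ he hab)
    have h2 : (q ^ 2) ^ a = (q ^ 2) ^ b := h1
    have hord : ¬ IsOfFinOrder (Units.mk0 q hq0 ^ 2) := by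
      rw [isOfFinOrder_iff_pow_eq_one]
      rintro ⟨n, hn, h⟩
      rw [← pow_mul] at h
      exact hq (2 * n) (by omega) (by simpa using congrArg Units.val h)
    exact injective_zpow_iff_not_isOfFinOrder.2 hord (Units.ext (by simpa using h2))
  have hzero := eq_zero_of_sum_eigenvectors_eq_zero (E := E) hinj (v := fun b => g b • w)
    (fun b => by
      have h := zpow_mul_eq_smul hq2 hKE b
      have h' : E * ((K ^ b : Aˣ) : A) = ((q ^ 2) ^ b)⁻¹ • (((K ^ b : Aˣ) : A) * E) := by
        rw [h, smul_smul, inv_mul_cancel₀ (zpow_ne_zero _ hq2), one_smul]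
      change E • g b • w = _ • g b • w
      rw [← hp, ← mul_smul, ← mul_assoc, hcp b E, mul_assoc, h', mul_smul_comm, Algebra.smul_def,
        mul_smul, ← mul_assoc, mul_smul _ E, hw, ← mul_smul _ (algebraMap ℂ A e),
        ← Algebra.commutes e, map_mul, mul_smul, mul_smul, mul_smul])
    hu
  refine S.add_mem hjS (S.sum_mem fun b hb => ?_)
  have hgb := hzero b hb
  simp only [← hp b, ← hcp b] at hgb ⊢
  rw [mul_smul] at hgb
  have hpw : aeval Z (p b) • w = 0 := by
    rw [← Units.smul_def] at hgb
    rwa [smul_eq_zero_iff_eq] at hgb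
  refine S.smul_mem _ (Submodule.subset_span (Or.inl ⟨aeval_mem_center hZ _, fun v => ?_⟩))
  obtain ⟨a, rfl⟩ := hcyc v
  rw [← mul_smul, ← hcp, mul_smul, hpw, smul_zero]

end Abstract

/-- `Kgen` as a unit with inverse `Kinvgen`. -/
def Kunit (q : ℂ) (m : ℕ) : (Uq q m)ˣ where
  val := Kgen q m
  inv := Kinvgen q m
  val_inv := by
    simpa [Kgen, Kinvgen] using RingQuot.mkAlgHom_rel ℂ (UqRel.KKinv (q := q) (m := m))
  inv_val := by
    simpa [Kgen, Kinvgen] using RingQuot.mkAlgHom_rel ℂ (UqRel.KinvK (q := q) (m := m))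

theorem Kgen_mul_Egen (q : ℂ) (m : ℕ) :
    Kgen q m * Egen q m = q ^ 2 • (Egen q m * Kgen q m) := by
  simpa [Kgen, Egen] using RingQuot.mkAlgHom_rel ℂ (UqRel.KE (q := q) (m := m))

theorem Kgen_mul_Fgen (q : ℂ) (m : ℕ) :
    Kgen q m * Fgen q m = (q ^ 2)⁻¹ • (Fgen q m * Kgen q m) := by
  simpa [Kgen, Fgen] using RingQuot.mkAlgHom_rel ℂ (UqRel.KF (q := q) (m := m))

theorem Egen_mul_Fgen_sub (q : ℂ) (m : ℕ) :
    Egen q m * Fgen q m - Fgen q m * Egen q m =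
      (q - q⁻¹)⁻¹ • (Kgen q m ^ m - Kinvgen q m ^ m) := by
  simpa [Kgen, Fgen, Egen, Kinvgen] using RingQuot.mkAlgHom_rel ℂ (UqRel.EF (q := q) (m := m))

theorem adjoin_gens_eq_top (q : ℂ) (m : ℕ) :
    Algebra.adjoin ℂ ({Egen q m, Fgen q m, Kgen q m, Kinvgen q m} : Set (Uq q m)) = ⊤ := by
  have h := congrArg (Subalgebra.map (RingQuot.mkAlgHom ℂ (UqRel q m)))
    (FreeAlgebra.adjoin_range_ι (R := ℂ) (X := UqGen))
  rw [AlgHom.map_adjoin, Algebra.map_top,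
    (AlgHom.range_eq_top _).2 (RingQuot.mkAlgHom_surjective ℂ _)] at h
  rw [eq_top_iff, ← h]
  refine Algebra.adjoin_mono ?_
  rintro _ ⟨_, ⟨g, rfl⟩, rfl⟩
  cases g <;> simp [Egen, Fgen, Kgen, Kinvgen]

theorem Casimir_mem_center {q : ℂ} {m : ℕ} (hm : 1 ≤ m) (hq0 : q ≠ 0)
    (hq : ∀ k : ℕ, 0 < k → q ^ k ≠ 1) : Casimir q m ∈ Subalgebra.center ℂ (Uq q m) := by
  have hQ : q ^ (2 * m) - 1 ≠ 0 := sub_ne_zero.2 (hq _ (by omega))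
  exact casimir_mem_center (K := Kunit q m) hq0 (adjoin_gens_eq_top q m) (Kgen_mul_Egen q m)
    (Kgen_mul_Fgen q m) (Egen_mul_Fgen_sub q m)
    (by rw [mul_inv, mul_comm, ← mul_assoc, mul_inv_cancel₀ hQ, one_mul])

/-- Let `V` be a Whittaker module for `U_q(f_m(K))` with cyclic
Whittaker vector `w` of type `η`, and `Z_V = Ann(V) ∩ Z(U_q(f_m(K)))`. Then the
annihilator of `w` equals `U_q(f_m(K))·Z_V + U_q(f_m(K))·U_{q,η}(E)` (the left ideal
generated by `Z_V` together with `ker η`). -/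
theorem stmt14 (q : ℂ) (m : ℕ) (hm : 1 ≤ m) (hq0 : q ≠ 0)
    (hq : ∀ k : ℕ, 0 < k → q ^ k ≠ 1)
    (η : ↥(Algebra.adjoin ℂ ({Egen q m} : Set (Uq q m))) →ₐ[ℂ] ℂ)
    (hη : η ⟨Egen q m, Algebra.subset_adjoin (Set.mem_singleton _)⟩ ≠ 0)
    (V : Type) [AddCommGroup V] [Module (Uq q m) V]
    (w : V) (hw0 : w ≠ 0)
    (hw : Egen q m • w =
      algebraMap ℂ (Uq q m) (η ⟨Egen q m, Algebra.subset_adjoin (Set.mem_singleton _)⟩) • w)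
    (hcyc : ∀ v : V, ∃ u : Uq q m, v = u • w) :
    {u : Uq q m | u • w = 0} =
      ↑(Submodule.span (Uq q m)
        ({z : Uq q m | z ∈ Subalgebra.center ℂ (Uq q m) ∧ ∀ v : V, z • v = 0} ∪
         {x : Uq q m | ∃ hx : x ∈ Algebra.adjoin ℂ ({Egen q m} : Set (Uq q m)),
            η ⟨x, hx⟩ = 0})) := by
  set e := η ⟨Egen q m, Algebra.subset_adjoin (Set.mem_singleton _)⟩ with he
  ext u
  constructor
  · intro hu
    have h := annihilator_whittaker_le_span (K := Kunit q m) hq0 hq hη (adjoin_gens_eq_top q m)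
      (Kgen_mul_Egen q m) (Kgen_mul_Fgen q m) (Casimir_mem_center hm hq0 hq) rfl hw hcyc hu
    refine Submodule.span_mono (Set.union_subset_union_right _ ?_) h
    rintro _ rfl
    refine ⟨sub_mem (Algebra.subset_adjoin (Set.mem_singleton _)) (Subalgebra.algebraMap_mem _ e),
      ?_⟩
    have h2 := map_sub η ⟨Egen q m, Algebra.subset_adjoin (Set.mem_singleton _)⟩
      (algebraMap ℂ _ e)
    rw [AlgHom.commutes, ← he] at h2
    exact h2.trans (sub_self e)
  · intro hu
    suffices Submodule.span (Uq q m) _ ≤ LinearMap.ker (LinearMap.toSpanSingleton (Uq q m) V w) from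
      this hu
    refine Submodule.span_le.2 ?_
    rintro x (⟨-, hx⟩ | ⟨hx, hx0⟩)
    · exact hx w
    · have key : x • w = algebraMap ℂ (Uq q m) (η ⟨x, hx⟩) • w := by
        clear hx0
        induction hx using Algebra.adjoin_induction with
        | mem y hy =>
          cases Set.mem_singleton_iff.1 hy
          exact hw
        | algebraMap r =>
          congr 2
          exact (η.commutes r).symm
        | add a b ha hb iha ihb =>
          rw [add_smul, iha, ihb, ← add_smul, ← map_add, ← map_add]
          rfl
        | mul a b ha hb iha ihb =>
          rw [mul_smul, ihb, ← mul_smul, ← Algebra.commutes, mul_smul, iha, ← mul_smul, ← map_mul,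
            mul_comm, ← map_mul]
          rfl
      change x • w = 0
      rw [key, hx0, map_zero, zero_smul]
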